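/- For m = 2, n = 2 (so mn = 4), the transformations r_j (j ∈ ℤ/4ℤ) satisfy the braid relations r_j r_{j+1} r_j = r_{j+1} r_j r_{j+1} as automorphisms of the rational function field ℂ(φ_{k,i} : k ∈ ℤ/4ℤ, i ∈ ℤ/2ℤ). -/

import Mathlib

/-- `P_{j,i} = 1 + φ_{j,i}` for `m = 2`. -/
noncomputable def polP2 {K : Type*} [Field K] (φ : ZMod 4 → ZMod 2 → K)
    (j : ZMod 4) (i : ZMod 2) : K := 1 + φ j i

/-- The substitution realizing the birational transformation `r_j` for `(m,n) = (2,2)`. -/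
noncomputable def rA {K : Type*} [Field K] (j : ZMod 4) (φ : ZMod 4 → ZMod 2 → K) :
    ZMod 4 → ZMod 2 → K := fun k i =>
  if k = j then (φ j (i + 1))⁻¹ * (polP2 φ j i / polP2 φ j (i + 2))
  else if k = j - 1 then φ (j - 1) i * φ j (i + 1) * (polP2 φ j (i + 2) / polP2 φ j (i + 1))
  else if k = j + 1 then φ j i * φ (j + 1) i * (polP2 φ j (i + 1) / polP2 φ j i)
  else φ k i

theorem zmod_two_add_two (i : ZMod 2) : i + 2 = i := by
  revert i; decide

theorem zmod_two_add_one_add_one (i : ZMod 2) : i + 1 + 1 = i := by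
  revert i; decide

theorem rA_self {K : Type*} [Field K] (j : ZMod 4) (φ : ZMod 4 → ZMod 2 → K) (i : ZMod 2)
    (h : polP2 φ j i ≠ 0) : rA j φ j i = (φ j (i + 1))⁻¹ := by
  simp [rA, zmod_two_add_two, div_self h]

theorem rA_pred {K : Type*} [Field K] (j : ZMod 4) (φ : ZMod 4 → ZMod 2 → K) (k : ZMod 4)
    (hk : k + 1 = j) (i : ZMod 2) :
    rA j φ k i = φ k i * φ j (i + 1) * ((1 + φ j i) / (1 + φ j (i + 1))) := by
  subst hk
  have h : ∀ k : ZMod 4, k ≠ k + 1 := by decide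
  simp only [rA, polP2, zmod_two_add_two, if_neg (h k), add_sub_cancel_right, if_true]

theorem rA_succ {K : Type*} [Field K] (j : ZMod 4) (φ : ZMod 4 → ZMod 2 → K) (k : ZMod 4)
    (hk : k = j + 1) (i : ZMod 2) :
    rA j φ k i = φ j i * φ k i * ((1 + φ j (i + 1)) / (1 + φ j i)) := by
  subst hk
  have h : ∀ j : ZMod 4, j + 1 ≠ j ∧ j + 1 ≠ j - 1 := by decide
  simp only [rA, polP2, if_neg (h j).1, if_neg (h j).2, if_true]

theorem rA_opposite {K : Type*} [Field K] (j : ZMod 4) (φ : ZMod 4 → ZMod 2 → K) (k : ZMod 4)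
    (hk : k = j + 2) (i : ZMod 2) : rA j φ k i = φ k i := by
  subst hk
  have h : ∀ j : ZMod 4, j + 2 ≠ j ∧ j + 2 ≠ j - 1 ∧ j + 2 ≠ j + 1 := by decide
  simp only [rA, if_neg (h j).1, if_neg (h j).2.1, if_neg (h j).2.2]

/-- Braid relation `r_j r_{j+1} r_j = r_{j+1} r_j r_{j+1}` for `(m,n) = (2,2)`, as an
identity of the corresponding substitutions on the variables (i.e. of field
automorphisms of `ℂ(φ)` evaluated at generic nonzero values). -/
theorem stmt7 {K : Type*} [Field K] (j : ZMod 4)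
    (φ : ZMod 4 → ZMod 2 → K) (hφ : ∀ k i, φ k i ≠ 0)
    (h0 : ∀ k i, polP2 φ k i ≠ 0)
    (h1 : ∀ k i, polP2 (rA j φ) k i ≠ 0)
    (h2 : ∀ k i, polP2 (rA (j + 1) φ) k i ≠ 0)
    (h3 : ∀ k i, polP2 (rA (j + 1) (rA j φ)) k i ≠ 0)
    (h4 : ∀ k i, polP2 (rA j (rA (j + 1) φ)) k i ≠ 0) :
    rA j (rA (j + 1) (rA j φ)) = rA (j + 1) (rA j (rA (j + 1) φ)) := by
  have hj : ∀ j : ZMod 4, j + 2 = j + 1 + 1 ∧ j + 3 + 1 = j ∧ j + 3 = j + 1 + 2 := by decide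
  have hcases : ∀ j k : ZMod 4, k = j ∨ k = j + 1 ∨ k = j + 2 ∨ k = j + 3 := by decide
  have hs : ∀ i : ZMod 2, i + 1 + 1 = i := zmod_two_add_one_add_one
  have a0 := hφ j
  have b0 := hφ (j + 1)
  have a1 : ∀ i, 1 + φ j i ≠ 0 := h0 j
  have b1 : ∀ i, 1 + φ (j + 1) i ≠ 0 := h0 (j + 1)
  have ra : ∀ i, rA j φ j i = (φ j (i + 1))⁻¹ := fun i => rA_self j φ i (h0 j i)
  have rb : ∀ i, rA (j + 1) φ (j + 1) i = (φ (j + 1) (i + 1))⁻¹ :=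
    fun i => rA_self _ φ i (h0 _ i)
  have rab := rA_succ j φ _ rfl
  have rba := rA_pred (j + 1) φ _ rfl
  obtain ⟨C, hC⟩ : ∃ C : ZMod 2 → K,
      ∀ i, C i = 1 + φ j i + φ j i * φ (j + 1) i * (1 + φ j (i + 1)) := ⟨_, fun _ => rfl⟩
  obtain ⟨D, hD⟩ : ∃ D : ZMod 2 → K, ∀ i, D i = 1 + φ (j + 1) (i + 1)
      + φ j i * φ (j + 1) (i + 1) * (1 + φ (j + 1) i) := ⟨_, fun _ => rfl⟩
  have rab' : ∀ i, 1 + rA j φ (j + 1) i = C i / (1 + φ j i) := by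
    intro i
    have := a1 i
    rw [rab, hC]
    field_simp
  have rba' : ∀ i, 1 + rA (j + 1) φ j i = D i / (1 + φ (j + 1) (i + 1)) := by
    intro i
    have := b1 (i + 1)
    rw [rba, hD]
    field_simp
  have c1 : ∀ i, C i ≠ 0 := fun i h => h1 (j + 1) i (by rw [polP2, rab', h, zero_div])
  have d1 : ∀ i, D i ≠ 0 := fun i h => h2 j i (by rw [polP2, rba', h, zero_div])
  have rabb : ∀ i, rA (j + 1) (rA j φ) (j + 1) i = (rA j φ (j + 1) (i + 1))⁻¹ :=
    fun i => rA_self _ _ i (h1 _ i)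
  have rbaa : ∀ i, rA j (rA (j + 1) φ) j i = (rA (j + 1) φ j (i + 1))⁻¹ :=
    fun i => rA_self _ _ i (h2 _ i)
  have raba : ∀ i, rA (j + 1) (rA j φ) j i = φ (j + 1) (i + 1) * C i / C (i + 1) := by
    intro i
    have := a0 (i + 1)
    have := a1 i
    have := a1 (i + 1)
    have := c1 (i + 1)
    rw [rA_pred (j + 1) _ j rfl, rab', rab', ra, rab, hs]
    field_simp
  have rbab : ∀ i, rA j (rA (j + 1) φ) (j + 1) i = φ j i * D (i + 1) / D i := by
    intro i
    have := b0 (i + 1)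
    have := b1 i
    have := b1 (i + 1)
    have := d1 i
    rw [rA_succ j _ _ rfl, rba', rba', rb, rba, hs]
    field_simp
  have raba' : ∀ i, 1 + rA (j + 1) (rA j φ) j i = (1 + φ j (i + 1)) * D i / C (i + 1) := by
    intro i
    have := c1 (i + 1)
    rw [raba]
    field_simp
    rw [hC, hC, hD, hs]
    ring
  have rbab' : ∀ i, 1 + rA j (rA (j + 1) φ) (j + 1) i
      = (1 + φ (j + 1) (i + 1)) * C i / D i := by
    intro i
    have := d1 i
    rw [rbab]
    field_simp
    rw [hC, hD, hD, hs]
    ring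
  funext k i
  have a0i := a0 i
  have a0i' := a0 (i + 1)
  have b0i := b0 i
  have b0i' := b0 (i + 1)
  have a1i := a1 i
  have a1i' := a1 (i + 1)
  have b1i := b1 i
  have b1i' := b1 (i + 1)
  have c1i := c1 i
  have c1i' := c1 (i + 1)
  have d1i := d1 i
  have d1i' := d1 (i + 1)
  rcases hcases j k with rfl | rfl | rfl | rfl
  · rw [rA_self _ _ _ (h3 _ _), rA_pred (k + 1) (rA k (rA (k + 1) φ)) k rfl, rbab', rbab', raba, rbaa, rba,
      rbab, hs]
    field_simp
  · rw [rA_self _ _ _ (h4 _ _), rA_succ j (rA (j + 1) (rA j φ)) _ rfl, raba', raba', raba, rabb, rab,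
      rbab, hs]
    field_simp
  · rw [rA_opposite j _ _ rfl, rA_succ (j + 1) _ _ (hj j).1, rA_succ (j + 1) _ _ (hj j).1,
      rbab', rbab', rab', rab', rA_opposite j _ _ rfl, rA_opposite j _ _ rfl,
      rA_succ (j + 1) _ _ (hj j).1, rbab, rab, hs]
    field_simp
  · rw [rA_opposite (j + 1) _ _ (hj j).2.2, rA_pred j _ _ (hj j).2.1, rA_pred j _ _ (hj j).2.1,
      raba', raba', rba', rba', rA_opposite (j + 1) _ _ (hj j).2.2,
      rA_opposite (j + 1) _ _ (hj j).2.2, rA_pred j _ _ (hj j).2.1, raba, rba, hs]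
    field_simp
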